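/- arXiv:2208.11239 — 4 statements merged into one kernel-verified Lean document; each statement's English description precedes it below -/
import Mathlib

section
/- Let X be a real Banach space of dimension at least 2. Then J(X)·S_P(X) ≥ C'_NJ(X) − 1. -/
/-- The P-angle constant `S_P(X)`. -/
noncomputable def SP (X : Type*) [NormedAddCommGroup X] [NormedSpace ℝ X] : ℝ :=
  sSup {r : ℝ | ∃ x y : X, ‖x‖ = 1 ∧ ‖y‖ = 1 ∧ x ≠ y ∧ x ≠ -y ∧
    r = (‖x + y‖ ^ 2 + ‖x - y‖ ^ 2 - 4) / (2 * ‖x + y‖ * ‖x - y‖)}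

/-- The modified von Neumann–Jordan constant `C'_NJ(X)`. -/
noncomputable def CNJ' (X : Type*) [NormedAddCommGroup X] [NormedSpace ℝ X] : ℝ :=
  sSup {r : ℝ | ∃ x y : X, ‖x‖ = 1 ∧ ‖y‖ = 1 ∧
    r = (‖x + y‖ ^ 2 + ‖x - y‖ ^ 2) / 4}

/-- The James constant `J(X)`. -/
noncomputable def JamesConst (X : Type*) [NormedAddCommGroup X] [NormedSpace ℝ X] : ℝ :=
  sSup {r : ℝ | ∃ x y : X, ‖x‖ = 1 ∧ ‖y‖ = 1 ∧ r = min ‖x + y‖ ‖x - y‖}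

section UnitSphere

variable {X : Type*} [NormedAddCommGroup X]

theorem norm_add_le_two {x y : X} (hx : ‖x‖ = 1) (hy : ‖y‖ = 1) : ‖x + y‖ ≤ 2 := by
  linarith [norm_add_le x y]

theorem norm_sub_le_two {x y : X} (hx : ‖x‖ = 1) (hy : ‖y‖ = 1) : ‖x - y‖ ≤ 2 := by
  linarith [norm_sub_le x y]

/-- The quotients defining `SP X` are bounded above by `1`. -/
theorem SP_quotient_le_one {x y : X} (hx : ‖x‖ = 1) (hy : ‖y‖ = 1) (h1 : x ≠ y) (h2 : x ≠ -y) :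
    (‖x + y‖ ^ 2 + ‖x - y‖ ^ 2 - 4) / (2 * ‖x + y‖ * ‖x - y‖) ≤ 1 := by
  have ha : 0 < ‖x + y‖ := norm_pos_iff.2 fun h => h2 (eq_neg_of_add_eq_zero_left h)
  have hb : 0 < ‖x - y‖ := norm_pos_iff.2 (sub_ne_zero.2 h1)
  have ha2 := norm_add_le_two hx hy
  have hb2 := norm_sub_le_two hx hy
  rw [div_le_one (by positivity)]
  rcases le_total ‖x + y‖ ‖x - y‖ with h | h <;> nlinarith

variable [NormedSpace ℝ X]

theorem le_SP {x y : X} (hx : ‖x‖ = 1) (hy : ‖y‖ = 1) (h1 : x ≠ y) (h2 : x ≠ -y) :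
    (‖x + y‖ ^ 2 + ‖x - y‖ ^ 2 - 4) / (2 * ‖x + y‖ * ‖x - y‖) ≤ SP X := by
  refine le_csSup ⟨1, ?_⟩ ⟨x, y, hx, hy, h1, h2, rfl⟩
  rintro r ⟨x, y, hx, hy, h1, h2, rfl⟩
  exact SP_quotient_le_one hx hy h1 h2

theorem le_JamesConst {x y : X} (hx : ‖x‖ = 1) (hy : ‖y‖ = 1) :
    min ‖x + y‖ ‖x - y‖ ≤ JamesConst X := by
  refine le_csSup ⟨2, ?_⟩ ⟨x, y, hx, hy, rfl⟩
  rintro r ⟨x, y, hx, hy, rfl⟩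
  exact (min_le_left _ _).trans (norm_add_le_two hx hy)

theorem JamesConst_nonneg : 0 ≤ JamesConst X := by
  refine Real.sSup_nonneg ?_
  rintro r ⟨x, y, -, -, rfl⟩
  positivity

/-- Every unit vector has an isosceles-orthogonal unit vector in dimension at least two. -/
theorem exists_norm_add_eq_norm_sub (hdim : 2 ≤ Module.rank ℝ X) {x : X} (hx : ‖x‖ = 1) :
    ∃ y : X, ‖y‖ = 1 ∧ ‖x + y‖ = ‖x - y‖ := by
  have hrank : 1 < Module.rank ℝ X := lt_of_lt_of_le (by norm_num) hdim
  have hconn := isPreconnected_sphere hrank (0 : X) 1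
  obtain ⟨y, hy, h⟩ := hconn.intermediate_value₂ (a := x) (b := -x)
    (f := fun y => ‖x - y‖) (g := fun y => ‖x + y‖)
    (by simpa using hx) (by simpa using hx) (by fun_prop) (by fun_prop)
    (by simp) (by simp)
  exact ⟨y, by simpa using hy, h.symm⟩

theorem SP_nonneg (hdim : 2 ≤ Module.rank ℝ X) : 0 ≤ SP X := by
  have : Nontrivial X := rank_pos_iff_nontrivial.1 (lt_of_lt_of_le (by norm_num) hdim)
  obtain ⟨x, hx⟩ := exists_norm_eq X zero_le_one
  obtain ⟨y, hy, hxy⟩ := exists_norm_add_eq_norm_sub hdim hx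
  have ha : 0 < ‖x + y‖ := by
    have h : ‖(2 : ℝ) • x‖ ≤ ‖x + y‖ + ‖x - y‖ := by
      rw [show (2 : ℝ) • x = (x + y) + (x - y) by module]
      exact norm_add_le _ _
    rw [norm_smul, hx, Real.norm_ofNat] at h
    linarith
  have hx0 : x ≠ 0 := norm_ne_zero_iff.1 (by simp [hx])
  have hy0 : y ≠ 0 := norm_ne_zero_iff.1 (by simp [hy])
  rcases le_total 2 (‖x + y‖ ^ 2) with h | h
  · have h1 : x ≠ y := sub_ne_zero.1 (norm_pos_iff.1 (hxy ▸ ha))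
    have h2 : x ≠ -y := fun h => norm_pos_iff.1 ha (by simp [h])
    refine le_trans ?_ (le_SP hx hy h1 h2)
    rw [← hxy]
    exact div_nonneg (by linarith) (by positivity)
  · set a := ‖x + y‖ with ha'
    have e1 : a⁻¹ • (x + y) + a⁻¹ • (x - y) = (2 * a⁻¹) • x := by module
    have e2 : a⁻¹ • (x + y) - a⁻¹ • (x - y) = (2 * a⁻¹) • y := by module
    have hc : 2 * a⁻¹ ≠ 0 := by positivity
    have n1 : ‖a⁻¹ • (x + y)‖ = 1 := by
      rw [norm_smul, ← ha', norm_inv, Real.norm_of_nonneg ha.le, inv_mul_cancel₀ ha.ne']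
    have n2 : ‖a⁻¹ • (x - y)‖ = 1 := by
      rw [norm_smul, ← hxy, norm_inv, Real.norm_of_nonneg ha.le, inv_mul_cancel₀ ha.ne']
    refine le_trans ?_ (le_SP n1 n2 (fun h => ?_) (fun h => ?_))
    · rw [e1, e2, norm_smul, norm_smul, hx, hy, Real.norm_of_nonneg (by positivity), mul_one]
      refine div_nonneg ?_ (by positivity)
      have : a⁻¹ ^ 2 * a ^ 2 = 1 := by field_simp
      nlinarith [sq_nonneg a⁻¹]
    · rw [← sub_eq_zero, e2] at h
      exact (smul_ne_zero hc hy0) h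
    · rw [eq_neg_iff_add_eq_zero, e1] at h
      exact (smul_ne_zero hc hx0) h

end UnitSphere

theorem stmt_5 (X : Type*) [NormedAddCommGroup X] [NormedSpace ℝ X] [CompleteSpace X]
    (hdim : 2 ≤ Module.rank ℝ X) :
    JamesConst X * SP X ≥ CNJ' X - 1 := by
  have : Nontrivial X := rank_pos_iff_nontrivial.1 (lt_of_lt_of_le (by norm_num) hdim)
  have hS := SP_nonneg hdim
  have hJ : 0 ≤ JamesConst X := JamesConst_nonneg
  obtain ⟨u, hu⟩ := exists_norm_eq X zero_le_one
  rw [ge_iff_le, sub_le_iff_le_add]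
  refine csSup_le ⟨_, u, u, hu, hu, rfl⟩ ?_
  rintro r ⟨x, y, hx, hy, rfl⟩
  have hprod := mul_nonneg hJ hS
  have ha2 := norm_add_le_two hx hy
  have hb2 := norm_sub_le_two hx hy
  by_cases h1 : x = y
  · have : ‖x - y‖ = 0 := by simp [h1]
    nlinarith [norm_nonneg (x + y)]
  by_cases h2 : x = -y
  · have : ‖x + y‖ = 0 := by simp [h2]
    nlinarith [norm_nonneg (x - y)]
  have ha : 0 < ‖x + y‖ := norm_pos_iff.2 fun h => h2 (eq_neg_of_add_eq_zero_left h)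
  have hb : 0 < ‖x - y‖ := norm_pos_iff.2 (sub_ne_zero.2 h1)
  have hSP := le_SP hx hy h1 h2
  rw [div_le_iff₀ (by positivity)] at hSP
  have hab : ‖x + y‖ * ‖x - y‖ ≤ 2 * JamesConst X := by
    rw [← min_mul_max, mul_comm]
    exact mul_le_mul (max_le ha2 hb2) (le_JamesConst hx hy) (by positivity) zero_le_two
  nlinarith [mul_le_mul_of_nonneg_left hab hS]
end

section
/- Let ℓ₁ be the real sequence space of all absolutely summable real sequences with the norm ‖x‖₁ = Σ|x_i|. Then S_P(ℓ₁) = 1/2. -/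
theorem pAngle_le_half {X : Type*} [NormedAddCommGroup X] {x y : X}
    (hx : ‖x‖ = 1) (hy : ‖y‖ = 1) (hxy : x ≠ y) (hxy' : x ≠ -y) :
    (‖x + y‖ ^ 2 + ‖x - y‖ ^ 2 - 4) / (2 * ‖x + y‖ * ‖x - y‖) ≤ 1 / 2 := by
  have hs : 0 < ‖x + y‖ := norm_pos_iff.2 fun h => hxy' (eq_neg_of_add_eq_zero_left h)
  have ht : 0 < ‖x - y‖ := norm_pos_iff.2 (sub_ne_zero.2 hxy)
  have hs2 : ‖x + y‖ ≤ 2 := (norm_add_le x y).trans (by rw [hx, hy]; norm_num)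
  have ht2 : ‖x - y‖ ≤ 2 := (norm_sub_le x y).trans (by rw [hx, hy]; norm_num)
  rw [div_le_iff₀ (by positivity)]
  rcases le_total ‖x + y‖ ‖x - y‖ with h | h <;> nlinarith

theorem lp_one_norm_single_add_single (a b : ℝ) :
    ‖(lp.single 1 0 a + lp.single 1 1 b : lp (fun _ : ℕ => ℝ) 1)‖ = |a| + |b| := by
  have h := lp.norm_sum_single (p := 1) (E := fun _ : ℕ => ℝ) (by simp)
    (fun i => if i = 0 then a else b) (Finset.range 2)
  simpa [Finset.sum_range_succ] using h

theorem stmt_13 : SP (lp (fun _ : ℕ => ℝ) 1) = 1 / 2 := by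
  refine IsGreatest.csSup_eq ⟨?_, ?_⟩
  · have hadd := lp_one_norm_single_add_single 1 1
    have hsub := lp_one_norm_single_add_single 1 (-1)
    rw [lp.single_neg, ← sub_eq_add_neg] at hsub
    norm_num at hadd hsub
    refine ⟨lp.single 1 0 1, lp.single 1 1 1, by simp, by simp, fun h => ?_, fun h => ?_, ?_⟩
    · rw [h, sub_self, norm_zero] at hsub
      norm_num at hsub
    · rw [h, neg_add_cancel, norm_zero] at hadd
      norm_num at hadd
    · rw [hadd, hsub]
      norm_num
  · rintro r ⟨x, y, hx, hy, hxy, hxy', rfl⟩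
    exact pAngle_le_half hx hy hxy hxy'
end

section
/- Let X be a real Banach space of dimension at least 2. If S_P(X) < (3 − √5)/4, then J(X) < (1 + √5)/2. -/
/-- The set whose supremum is `SP X` is bounded above. -/
theorem bddAbove_pAngle (X : Type*) [NormedAddCommGroup X] [NormedSpace ℝ X] :
    BddAbove {r : ℝ | ∃ x y : X, ‖x‖ = 1 ∧ ‖y‖ = 1 ∧ x ≠ y ∧ x ≠ -y ∧
      r = (‖x + y‖ ^ 2 + ‖x - y‖ ^ 2 - 4) / (2 * ‖x + y‖ * ‖x - y‖)} := by
  refine ⟨1 / 2, ?_⟩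
  rintro r ⟨x, y, hx, hy, hne, hne', rfl⟩
  have ha : 0 < ‖x + y‖ := norm_pos_iff.2 fun h => hne' (eq_neg_of_add_eq_zero_left h)
  have hb : 0 < ‖x - y‖ := norm_sub_pos_iff.2 hne
  have ha2 : ‖x + y‖ ≤ 2 := by linarith [norm_add_le x y]
  have hb2 : ‖x - y‖ ≤ 2 := by linarith [norm_sub_le x y]
  rw [div_le_iff₀ (by positivity)]
  rcases le_total ‖x + y‖ ‖x - y‖ with hab | hab <;> nlinarith

/-- If `SP X < 1 / 5`, then `‖x + y‖` and `‖x - y‖` cannot both exceed `8 / 5` for unit `x`, `y`. -/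
theorem min_norm_le_of_SP_lt {X : Type*} [NormedAddCommGroup X] [NormedSpace ℝ X]
    (h : SP X < 1 / 5) {x y : X} (hx : ‖x‖ = 1) (hy : ‖y‖ = 1) :
    min ‖x + y‖ ‖x - y‖ ≤ 8 / 5 := by
  by_contra! hlt
  obtain ⟨ha, hb⟩ := lt_min_iff.1 hlt
  have hne : x ≠ y := by
    rintro rfl
    norm_num at hb
  have hne' : x ≠ -y := by
    rintro rfl
    norm_num at ha
  have hle := le_csSup (bddAbove_pAngle X) ⟨x, y, hx, hy, hne, hne', rfl⟩
  have hge : 1 / 5 ≤ (‖x + y‖ ^ 2 + ‖x - y‖ ^ 2 - 4) / (2 * ‖x + y‖ * ‖x - y‖) := by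
    rw [le_div_iff₀ (by nlinarith)]
    nlinarith [sq_nonneg (‖x + y‖ - ‖x - y‖)]
  exact absurd h (not_lt.2 (hge.trans hle))

theorem stmt_15 (X : Type*) [NormedAddCommGroup X] [NormedSpace ℝ X] [CompleteSpace X]
    (hdim : 2 ≤ Module.rank ℝ X) (h : SP X < (3 - Real.sqrt 5) / 4) :
    JamesConst X < (1 + Real.sqrt 5) / 2 := by
  have h5 : (2.21 : ℝ) < Real.sqrt 5 := Real.lt_sqrt_of_sq_lt (by norm_num)
  have hJ : JamesConst X ≤ 8 / 5 := by
    refine Real.sSup_le ?_ (by norm_num)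
    rintro r ⟨x, y, hx, hy, rfl⟩
    exact min_norm_le_of_SP_lt (by linarith) hx hy
  linarith
end

section
/- Let X be a finite-dimensional real Banach space of dimension at least 2. If S_P(X) < 1/8, then γ_X(1) < 5/2; that is, there exists t ∈ (0, 1] with 2γ_X(t) < 1 + (1 + t)². -/
/-- The function `γ_X(t)`. -/
noncomputable def gammaX (X : Type*) [NormedAddCommGroup X] [NormedSpace ℝ X] (t : ℝ) : ℝ :=
  sSup {r : ℝ | ∃ x y : X, ‖x‖ = 1 ∧ ‖y‖ = 1 ∧
    r = (‖x + t • y‖ ^ 2 + ‖x - t • y‖ ^ 2) / 2}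

/-- If two positive reals are at most `2`, the quotient defining the P-angle constant is at
most `1 / 2`. -/
theorem pAngle_quotient_le_half {a b : ℝ} (ha : 0 < a) (hb : 0 < b) (ha2 : a ≤ 2) (hb2 : b ≤ 2) :
    (a ^ 2 + b ^ 2 - 4) / (2 * a * b) ≤ 1 / 2 := by
  rw [div_le_iff₀ (by positivity)]
  rcases le_total a b with h | h <;> nlinarith

/-- Each quotient in the definition of `SP X` is at most `SP X`. -/
theorem pAngle_quotient_le_SP {X : Type*} [NormedAddCommGroup X] [NormedSpace ℝ X] {x y : X}
    (hx : ‖x‖ = 1) (hy : ‖y‖ = 1) (hne : x ≠ y) (hne' : x ≠ -y) :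
    (‖x + y‖ ^ 2 + ‖x - y‖ ^ 2 - 4) / (2 * ‖x + y‖ * ‖x - y‖) ≤ SP X := by
  refine le_csSup ⟨1 / 2, ?_⟩ ⟨x, y, hx, hy, hne, hne', rfl⟩
  rintro r ⟨u, v, hu, hv, huv, huv', rfl⟩
  have hadd : ‖u + v‖ ≤ 2 := by linarith [norm_add_le u v]
  have hsub : ‖u - v‖ ≤ 2 := by linarith [norm_sub_le u v]
  have hadd_pos : 0 < ‖u + v‖ := norm_pos_iff.2 fun h => huv' (eq_neg_of_add_eq_zero_left h)
  exact pAngle_quotient_le_half hadd_pos (norm_pos_iff.2 (sub_ne_zero.2 huv)) hadd hsub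

theorem norm_add_sq_add_norm_sub_sq_le_SP {X : Type*} [NormedAddCommGroup X] [NormedSpace ℝ X]
    {x y : X} (hx : ‖x‖ = 1) (hy : ‖y‖ = 1) :
    ‖x + y‖ ^ 2 + ‖x - y‖ ^ 2 ≤ 4 + 8 * max (SP X) 0 := by
  have hadd : ‖x + y‖ ≤ 2 := by linarith [norm_add_le x y]
  have hsub : ‖x - y‖ ≤ 2 := by linarith [norm_sub_le x y]
  have hmax : 0 ≤ max (SP X) 0 := le_max_right _ _
  have hadd0 := norm_nonneg (x + y)
  have hsub0 := norm_nonneg (x - y)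
  by_cases hne : x = y
  · have : ‖x - y‖ = 0 := by simp [hne]
    nlinarith
  by_cases hne' : x = -y
  · have : ‖x + y‖ = 0 := by simp [hne']
    nlinarith
  have hadd_pos : 0 < ‖x + y‖ := norm_pos_iff.2 fun h => hne' (eq_neg_of_add_eq_zero_left h)
  have hsub_pos : 0 < ‖x - y‖ := norm_pos_iff.2 (sub_ne_zero.2 hne)
  have hq := (pAngle_quotient_le_SP hx hy hne hne').trans (le_max_left _ 0)
  rw [div_le_iff₀ (by positivity)] at hq
  have hprod : ‖x + y‖ * ‖x - y‖ ≤ 4 := by nlinarith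
  nlinarith [mul_le_mul_of_nonneg_left hprod hmax]

theorem gammaX_one_le (X : Type*) [NormedAddCommGroup X] [NormedSpace ℝ X] :
    gammaX X 1 ≤ 2 + 4 * max (SP X) 0 := by
  refine Real.sSup_le ?_ (by positivity)
  rintro r ⟨x, y, hx, hy, rfl⟩
  rw [one_smul]
  linarith [norm_add_sq_add_norm_sub_sq_le_SP hx hy]

theorem stmt_17 (X : Type*) [NormedAddCommGroup X] [NormedSpace ℝ X]
    [FiniteDimensional ℝ X] (hdim : 2 ≤ Module.rank ℝ X) (h : SP X < 1 / 8) :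
    gammaX X 1 < 5 / 2 ∧
      ∃ t : ℝ, t ∈ Set.Ioc (0 : ℝ) 1 ∧ 2 * gammaX X t < 1 + (1 + t) ^ 2 := by
  have hmax : max (SP X) 0 < 1 / 8 := max_lt h (by norm_num)
  have hgamma : gammaX X 1 < 5 / 2 := by linarith [gammaX_one_le X]
  exact ⟨hgamma, 1, by norm_num, by linarith⟩
end
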